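/- arXiv:2411.04449 — 2 statements merged into one kernel-verified Lean document; each statement's English description precedes it below -/
import Mathlib

section
/- Let n be a natural number written as n = 3k + ℓ with 0 ≤ ℓ ≤ 2. Then the maximum number of 3-element subsets with rational sum over all n-element sets of irrational real numbers equals k·C(2k+ℓ, 2), i.e. h(n,3) = k·binomial(2k+ℓ, 2). -/
open Classical in
/-- The number of `r`-element subsets of `A` with rational sum. -/
noncomputable def ratSumCount (A : Finset ℝ) (r : ℕ) : ℕ :=
  ((A.powersetCard r).filter (fun B => ∃ q : ℚ, (∑ x ∈ B, x) = (q : ℝ))).card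

/-- `h n r`: the maximum number of `r`-element subsets with rational sum over all
`n`-element sets of irrational real numbers. -/
noncomputable def maxRatSum (n r : ℕ) : ℕ :=
  sSup {k : ℕ | ∃ A : Finset ℝ, A.card = n ∧ (∀ x ∈ A, Irrational x) ∧ ratSumCount A r = k}

/-- The 3-element subsets of `A` on which the weight `f` sums to zero. -/
def zeroTriples {α : Type*} [DecidableEq α] (f : α → ℚ) (A : Finset α) : Finset (Finset α) :=
  (A.powersetCard 3).filter (fun B => ∑ x ∈ B, f x = 0)

section ZeroTriples

variable {α : Type*} [DecidableEq α] {f : α → ℚ} {A : Finset α}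

lemma mem_zeroTriples {B : Finset α} :
    B ∈ zeroTriples f A ↔ (B ⊆ A ∧ B.card = 3) ∧ ∑ x ∈ B, f x = 0 := by
  simp [zeroTriples]

lemma zeroTriples_neg : zeroTriples (fun x => -f x) A = zeroTriples f A := by
  simp [zeroTriples]

lemma card_zeroTriples_le_erase_add (x : α) :
    (zeroTriples f A).card ≤
      (zeroTriples f (A.erase x)).card + ((zeroTriples f A).filter (x ∈ ·)).card := by
  refine le_trans (Finset.card_le_card ?_) (Finset.card_union_le _ _)
  intro B hB
  by_cases hx : x ∈ B
  · exact Finset.mem_union_right _ (Finset.mem_filter.2 ⟨hB, hx⟩)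
  · rw [mem_zeroTriples] at hB
    exact Finset.mem_union_left _
      (mem_zeroTriples.2 ⟨⟨Finset.subset_erase.2 ⟨hB.1.1, hx⟩, hB.1.2⟩, hB.2⟩)

lemma exists_pair_of_mem_zeroTriples {x : α} {B : Finset α} (hB : B ∈ zeroTriples f A)
    (hx : x ∈ B) : ∃ a ∈ A, ∃ b ∈ A, a ≠ b ∧ a ≠ x ∧ b ≠ x ∧ B = insert x {a, b} ∧
      f x + f a + f b = 0 := by
  rw [mem_zeroTriples] at hB
  obtain ⟨⟨hBA, hB3⟩, hsum⟩ := hB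
  have h2 : (B.erase x).card = 2 := by rw [Finset.card_erase_of_mem hx, hB3]
  obtain ⟨a, b, hab, hE⟩ := Finset.card_eq_two.1 h2
  have ha : a ∈ B.erase x := by simp [hE]
  have hb : b ∈ B.erase x := by simp [hE]
  rw [Finset.mem_erase] at ha hb
  refine ⟨a, hBA ha.2, b, hBA hb.2, hab, ha.1, hb.1, ?_, ?_⟩
  · rw [← hE, Finset.insert_erase hx]
  · rw [← Finset.add_sum_erase _ _ hx, hE, Finset.sum_pair hab] at hsum
    linarith

/-- A positive element of maximal absolute value only forms zero triples with two negatives. -/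
lemma card_zeroTriples_filter_mem_le_choose {x : α} (hx : 0 < f x) (h0 : ∀ y ∈ A, f y ≠ 0)
    (hmax : ∀ y ∈ A, |f y| ≤ |f x|) :
    ((zeroTriples f A).filter (x ∈ ·)).card ≤ (A.filter (f · < 0)).card.choose 2 := by
  rw [← Finset.card_powersetCard]
  refine le_trans (Finset.card_le_card (t := ((A.filter (f · < 0)).powersetCard 2).image
    (insert x)) ?_) Finset.card_image_le
  intro B hB
  rw [Finset.mem_filter] at hB
  obtain ⟨a, ha, b, hb, hab, -, -, hBe, hsum⟩ := exists_pair_of_mem_zeroTriples hB.1 hB.2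
  have ha' := (abs_le.1 (hmax a ha)).1
  have hb' := (abs_le.1 (hmax b hb)).1
  rw [abs_of_pos hx] at ha' hb'
  have ha0 : f a < 0 := lt_of_le_of_ne (by linarith) (h0 a ha)
  have hb0 : f b < 0 := lt_of_le_of_ne (by linarith) (h0 b hb)
  rw [Finset.mem_image]
  refine ⟨{a, b}, ?_, hBe.symm⟩
  rw [Finset.mem_powersetCard, Finset.card_pair hab]
  refine ⟨?_, rfl⟩
  simp [Finset.insert_subset_iff, ha, hb, ha0, hb0]

lemma card_zeroTriples_filter_mem_le_mul {y : α} (hyA : y ∈ A) (hy : f y < 0)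
    (h0 : ∀ x ∈ A, f x ≠ 0)
    (hcard : (A.filter (0 < f ·)).card ≤ (A.filter (f · < 0)).card) :
    ((zeroTriples f A).filter (y ∈ ·)).card ≤
      (A.filter (0 < f ·)).card * ((A.filter (f · < 0)).card - 1) := by
  set P := A.filter (0 < f ·) with hP
  set N := A.filter (f · < 0) with hN
  set S := P.filter (fun z => f z < -f y) with hS
  set L := P.filter (fun z => ¬ f z < -f y) with hL
  have hSL : S.card + L.card = P.card := Finset.card_filter_add_card_filter_not _
  have hyN : y ∈ N := by simp [hN, hyA, hy]
  have hsub : (zeroTriples f A).filter (y ∈ ·) ⊆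
      (S.powersetCard 2).image (insert y) ∪
        (L ×ˢ N.erase y).image (fun p => insert y {p.1, p.2}) := by
    intro B hB
    rw [Finset.mem_filter] at hB
    obtain ⟨a, ha, b, hb, hab, hay, hby, hBe, hsum⟩ := exists_pair_of_mem_zeroTriples hB.1 hB.2
    rw [Finset.mem_union, Finset.mem_image, Finset.mem_image]
    rcases lt_or_gt_of_ne (h0 a ha) with ha0 | ha0 <;>
      rcases lt_or_gt_of_ne (h0 b hb) with hb0 | hb0
    · linarith
    · right
      refine ⟨(b, a), ?_, by rw [hBe, Finset.pair_comm]⟩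
      simp only [Finset.mem_product, Finset.mem_erase, hL, hP, hN, Finset.mem_filter]
      exact ⟨⟨⟨hb, hb0⟩, by linarith⟩, hay, ha, ha0⟩
    · right
      refine ⟨(a, b), ?_, hBe.symm⟩
      simp only [Finset.mem_product, Finset.mem_erase, hL, hP, hN, Finset.mem_filter]
      exact ⟨⟨⟨ha, ha0⟩, by linarith⟩, hby, hb, hb0⟩
    · left
      refine ⟨{a, b}, ?_, hBe.symm⟩
      rw [Finset.mem_powersetCard, Finset.card_pair hab]
      refine ⟨?_, rfl⟩
      simp only [Finset.insert_subset_iff, Finset.singleton_subset_iff, hS, hP, Finset.mem_filter]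
      exact ⟨⟨⟨ha, ha0⟩, by linarith⟩, ⟨hb, hb0⟩, by linarith⟩
  have hSN : S.card - 1 ≤ N.card - 1 := by omega
  calc _ ≤ _ := Finset.card_le_card hsub
    _ ≤ _ := Finset.card_union_le _ _
    _ ≤ S.card.choose 2 + L.card * (N.card - 1) := by
      refine add_le_add (Finset.card_image_le.trans (Finset.card_powersetCard _ _).le)
        (Finset.card_image_le.trans ?_)
      rw [Finset.card_product, Finset.card_erase_of_mem hyN]
    _ ≤ S.card * (N.card - 1) + L.card * (N.card - 1) := by
      refine Nat.add_le_add_right ?_ _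
      rw [Nat.choose_two_right]
      exact (Nat.div_le_self _ _).trans (Nat.mul_le_mul_left _ hSN)
    _ = P.card * (N.card - 1) := by rw [← add_mul, hSL]

/-- Some element of `A` lies in at most `d` zero triples: an element of maximal absolute value if
at most `t` elements have the opposite sign, and any element of the opposite sign otherwise. -/
lemma exists_card_zeroTriples_filter_mem_le {d t : ℕ} (hA : A.Nonempty) (h0 : ∀ x ∈ A, f x ≠ 0)
    (hchoose : t.choose 2 ≤ d) (ht : A.card ≤ 2 * t + 2)
    (hmul : ∀ p q, p + q = A.card → t < q → p * (q - 1) ≤ d) :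
    ∃ x ∈ A, ((zeroTriples f A).filter (x ∈ ·)).card ≤ d := by
  obtain ⟨x, hxA, hmax⟩ := A.exists_max_image (fun y => |f y|) hA
  wlog hx : 0 < f x generalizing f
  · have hx' : f x < 0 := lt_of_le_of_ne (not_lt.1 hx) (h0 x hxA)
    have := this (f := fun y => -f y) (fun y hy => neg_ne_zero.2 (h0 y hy))
      (fun y hy => by simpa using hmax y hy) (by simpa using hx')
    rwa [zeroTriples_neg] at this
  rcases le_or_gt (A.filter (f · < 0)).card t with hq | hq
  · exact ⟨x, hxA, (card_zeroTriples_filter_mem_le_choose hx h0 hmax).trans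
      ((Nat.choose_le_choose 2 hq).trans hchoose)⟩
  · obtain ⟨y, hy⟩ := Finset.card_pos.1 (Nat.zero_lt_of_lt hq)
    rw [Finset.mem_filter] at hy
    have hsum : (A.filter (0 < f ·)).card + (A.filter (f · < 0)).card = A.card := by
      rw [← Finset.card_filter_add_card_filter_not (s := A) (fun x => 0 < f x)]
      congr 2
      refine Finset.filter_congr fun z hz => ?_
      have := h0 z hz
      rw [not_lt]
      exact ⟨le_of_lt, fun h => lt_of_le_of_ne h this⟩
    exact ⟨y, hy.1, (card_zeroTriples_filter_mem_le_mul hy.1 hy.2 h0 (by omega)).trans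
      (hmul _ _ hsum hq)⟩

theorem card_zeroTriples_le (n k l : ℕ) (hl : l ≤ 2) (hn : n = 3 * k + l) (hA : A.card = n)
    (h0 : ∀ x ∈ A, f x ≠ 0) : (zeroTriples f A).card ≤ k * (2 * k + l).choose 2 := by
  induction n generalizing A k l with
  | zero =>
    rw [zeroTriples, Finset.powersetCard_eq_empty.2 (by omega)]
    simp
  | succ n ih =>
    have hne : A.Nonempty := Finset.card_pos.1 (by omega)
    obtain ⟨d, t, k', l', hl', hn', hd, hchoose, ht, hmul⟩ : ∃ d t k' l', l' ≤ 2 ∧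
        n = 3 * k' + l' ∧ k' * (2 * k' + l').choose 2 + d ≤ k * (2 * k + l).choose 2 ∧
        t.choose 2 ≤ d ∧ A.card ≤ 2 * t + 2 ∧
        ∀ p q, p + q = A.card → t < q → p * (q - 1) ≤ d := by
      have hchoose_odd (m : ℕ) : (2 * m + 1).choose 2 = m * (2 * m + 1) := by
        rw [Nat.choose_two_right, Nat.add_sub_cancel, mul_left_comm,
          Nat.mul_div_cancel_left _ two_pos, mul_comm]
      have hchoose_even (m : ℕ) : (2 * m + 2).choose 2 = (m + 1) * (2 * m + 1) := by
        rw [Nat.choose_succ_succ' (2 * m + 1) 1, hchoose_odd, Nat.choose_one_right]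
        ring
      have hmul_le {a b p q : ℕ} (hpq : p + q = a + b + 1) (hq : b < q) (hab : a ≤ b + 1) :
          p * (q - 1) ≤ a * b := by
        obtain ⟨c, rfl⟩ : ∃ c, q = b + 1 + c := ⟨q - (b + 1), by omega⟩
        obtain rfl : a = p + c := by omega
        rw [show b + 1 + c - 1 = b + c by omega]
        rcases Nat.eq_zero_or_pos c with rfl | hc
        · simp
        · nlinarith
      interval_cases l
      · obtain ⟨j, rfl⟩ : ∃ j, k = j + 1 := ⟨k - 1, by omega⟩
        refine ⟨(j + 1) * (2 * j + 1), 2 * j + 2, j, 2, le_rfl, by omega, ?_,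
          (hchoose_even j).le, by omega, fun p q hpq hq => ?_⟩
        · rw [show 2 * (j + 1) + 0 = 2 * j + 2 by ring, hchoose_even]
          exact (by ring : _ = _).le
        · refine (hmul_le (a := j) (b := 2 * j + 2) (by omega) hq (by omega)).trans ?_
          nlinarith
      · refine ⟨k * (2 * k), 2 * k, k, 0, by omega, by omega, ?_, ?_, by omega,
          fun p q hpq hq => hmul_le (by omega) hq (by omega)⟩
        · rw [Nat.choose_succ_succ' (2 * k) 1, Nat.choose_one_right, add_zero]
          exact (by ring : _ = _).le
        · rw [Nat.choose_two_right]
          exact Nat.div_le_of_le_mul (by nlinarith [Nat.sub_le (2 * k) 1])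
      · refine ⟨k * (2 * k + 1), 2 * k + 1, k, 1, by omega, by omega, ?_, (hchoose_odd k).le,
          by omega, fun p q hpq hq => hmul_le (by omega) hq (by omega)⟩
        rw [hchoose_even, hchoose_odd]
        exact (by ring : _ = _).le
    obtain ⟨x, hxA, hx⟩ := exists_card_zeroTriples_filter_mem_le hne h0 hchoose ht hmul
    have := ih k' l' hl' hn' (A := A.erase x) (by rw [Finset.card_erase_of_mem hxA, hA]; rfl)
      (fun y hy => h0 y (Finset.mem_of_mem_erase hy))
    have := card_zeroTriples_le_erase_add (f := f) (A := A) x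
    omega

end ZeroTriples

lemma exists_linearMap_ratCast_eq_zero_forall_ne_zero (A : Finset ℝ) (hA : ∀ x ∈ A, Irrational x) :
    ∃ f : ℝ →ₗ[ℚ] ℚ, (∀ q : ℚ, f q = 0) ∧ ∀ x ∈ A, f x ≠ 0 := by
  let S : Submodule ℚ ℝ := Submodule.span ℚ {1}
  obtain ⟨g, hg⟩ := Module.exists_dual_forall_apply_ne_zero (K := ℚ)
    (fun x : A => S.mkQ (x : ℝ)) (by
      rintro ⟨x, hx⟩ h
      rw [Submodule.mkQ_apply, Submodule.Quotient.mk_eq_zero, Submodule.mem_span_singleton] at h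
      obtain ⟨q, hq⟩ := h
      exact hA x hx ⟨q, by rw [Rat.smul_def, mul_one] at hq; exact hq⟩)
  refine ⟨g.comp S.mkQ, fun q => ?_, fun x hx => hg ⟨x, hx⟩⟩
  have : S.mkQ (q : ℝ) = 0 := by
    rw [Submodule.mkQ_apply, Submodule.Quotient.mk_eq_zero, Submodule.mem_span_singleton]
    exact ⟨q, by rw [Rat.smul_def, mul_one]⟩
  rw [LinearMap.comp_apply, this, map_zero]

lemma ratSumCount_three_le {n k l : ℕ} (hl : l ≤ 2) (hn : n = 3 * k + l) {A : Finset ℝ}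
    (hcard : A.card = n) (hA : ∀ x ∈ A, Irrational x) :
    ratSumCount A 3 ≤ k * (2 * k + l).choose 2 := by
  classical
  obtain ⟨f, hf, hf0⟩ := exists_linearMap_ratCast_eq_zero_forall_ne_zero A hA
  refine le_trans (Finset.card_le_card ?_) (card_zeroTriples_le n k l hl hn hcard hf0)
  intro B hB
  rw [Finset.mem_filter, Finset.mem_powersetCard] at hB
  obtain ⟨hB, q, hq⟩ := hB
  exact mem_zeroTriples.2 ⟨hB, by rw [← map_sum, hq, hf]⟩

lemma mul_choose_two_le_ratSumCount {U W : Finset ℝ} (hUW : Disjoint U W)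
    (hsum : ∀ u ∈ U, ∀ a ∈ W, ∀ b ∈ W, ∃ q : ℚ, u + (a + b) = q) :
    U.card * W.card.choose 2 ≤ ratSumCount (U ∪ W) 3 := by
  classical
  have hnot {u : ℝ} (hu : u ∈ U) : u ∉ W := Finset.disjoint_left.1 hUW hu
  rw [← Finset.card_powersetCard, ← Finset.card_product]
  refine Finset.card_le_card_of_injOn (fun p => insert p.1 p.2) ?_ ?_
  · rintro ⟨u, S⟩ hp
    simp only [Finset.coe_product, Set.mem_prod, Finset.mem_coe, Finset.mem_powersetCard] at hp
    obtain ⟨hu, hSW, hS⟩ := hp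
    have huS : u ∉ S := fun h => hnot hu (hSW h)
    simp only [Finset.coe_filter, Set.mem_ofPred_eq, Finset.mem_powersetCard]
    refine ⟨⟨Finset.insert_subset (Finset.mem_union_left _ hu)
      (hSW.trans Finset.subset_union_right), by rw [Finset.card_insert_of_notMem huS, hS]⟩, ?_⟩
    obtain ⟨a, b, hab, rfl⟩ := Finset.card_eq_two.1 hS
    rw [Finset.sum_insert huS, Finset.sum_pair hab]
    exact hsum u hu a (hSW (by simp)) b (hSW (by simp))
  · rintro ⟨u, S⟩ hp ⟨v, T⟩ hq h
    simp only [Finset.coe_product, Set.mem_prod, Finset.mem_coe, Finset.mem_powersetCard] at hp hq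
    dsimp only at h
    have huv : u = v := by
      have : u ∈ insert v T := h ▸ Finset.mem_insert_self u S
      exact (Finset.mem_insert.1 this).resolve_right fun h' => hnot hp.1 (hq.2.1 h')
    subst huv
    have huS : u ∉ S := fun h => hnot hp.1 (hp.2.1 h)
    have huT : u ∉ T := fun h => hnot hp.1 (hq.2.1 h)
    rw [← Finset.erase_insert huS, h, Finset.erase_insert huT]

lemma exists_mul_choose_two_le_ratSumCount (k m : ℕ) :
    ∃ A : Finset ℝ, A.card = k + m ∧ (∀ x ∈ A, Irrational x) ∧
      k * m.choose 2 ≤ ratSumCount A 3 := by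
  classical
  let u : ℕ → ℝ := fun i => √2 * (-2 : ℤ) + i
  let w : ℕ → ℝ := fun i => √2 + i
  have hu : Function.Injective u := fun i j h => by simpa [u] using h
  have hw : Function.Injective w := fun i j h => by simpa [w] using h
  have hdisj : Disjoint ((Finset.range k).image u) ((Finset.range m).image w) := by
    simp only [Finset.disjoint_left, Finset.mem_image]
    rintro _ ⟨i, -, rfl⟩ ⟨j, -, h⟩
    refine (irrational_sqrt_two.mul_intCast (m := 3) (by norm_num)) ⟨(i : ℚ) - j, ?_⟩
    simp only [u, w] at h
    push_cast at h ⊢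
    linarith
  refine ⟨_, ?_, ?_, le_trans (le_of_eq ?_) (mul_choose_two_le_ratSumCount hdisj ?_)⟩
  · rw [Finset.card_union_of_disjoint hdisj, Finset.card_image_of_injective _ hu,
      Finset.card_image_of_injective _ hw, Finset.card_range, Finset.card_range]
  · intro x hx
    rw [Finset.mem_union, Finset.mem_image, Finset.mem_image] at hx
    obtain ⟨i, -, rfl⟩ | ⟨i, -, rfl⟩ := hx
    · exact (irrational_sqrt_two.mul_intCast (by norm_num)).add_natCast i
    · exact irrational_sqrt_two.add_natCast i
  · rw [Finset.card_image_of_injective _ hu,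
      Finset.card_image_of_injective _ hw, Finset.card_range, Finset.card_range]
  · simp only [Finset.mem_image]
    rintro _ ⟨i, -, rfl⟩ _ ⟨a, -, rfl⟩ _ ⟨b, -, rfl⟩
    refine ⟨(i : ℚ) + a + b, ?_⟩
    simp only [u, w]
    push_cast
    ring

theorem h_n_three (n k l : ℕ) (hl : l ≤ 2) (hn : n = 3 * k + l) :
    maxRatSum n 3 = k * Nat.choose (2 * k + l) 2 := by
  obtain ⟨A, hcard, hA, hle⟩ := exists_mul_choose_two_le_ratSumCount k (2 * k + l)
  have hcard' : A.card = n := by omega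
  refine IsGreatest.csSup_eq ⟨⟨A, hcard', hA, ?_⟩, ?_⟩
  · exact le_antisymm (ratSumCount_three_le hl hn hcard' hA) hle
  · rintro _ ⟨B, hB, hirr, rfl⟩
    exact ratSumCount_three_le hl hn hB hirr
end

section
/- Let n, r be natural numbers with n = 2r and r ≥ 2. Then the maximum number of r-element subsets with rational sum over all n-element sets of irrational real numbers equals 2·C(n−2, r−1), i.e. h(n, n/2) = 2·binomial(n−2, r−1). -/
/-- Two sets with rational sums that each contain exactly one of `x` and `y` and agree off `{x, y}`
are equal when `x - y` is irrational. -/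
lemma eq_of_erase_erase_eq {x y : ℝ} (hxy : Irrational (x - y)) {B C : Finset ℝ}
    (hB : x ∈ B ∧ y ∉ B ∨ x ∉ B ∧ y ∈ B) (hC : x ∈ C ∧ y ∉ C ∨ x ∉ C ∧ y ∈ C)
    (hBq : ∃ q : ℚ, ∑ z ∈ B, z = (q : ℝ)) (hCq : ∃ q : ℚ, ∑ z ∈ C, z = (q : ℝ))
    (h : (B.erase x).erase y = (C.erase x).erase y) : B = C := by
  obtain ⟨p, hp⟩ := hBq
  obtain ⟨q, hq⟩ := hCq
  have left {D : Finset ℝ} (hD : x ∈ D ∧ y ∉ D) : (D.erase x).erase y = D.erase x :=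
    Finset.erase_eq_of_notMem fun hy => hD.2 (Finset.mem_of_mem_erase hy)
  have right {D : Finset ℝ} (hD : x ∉ D ∧ y ∈ D) : (D.erase x).erase y = D.erase y := by
    rw [Finset.erase_eq_of_notMem hD.1]
  have sum {D : Finset ℝ} {z : ℝ} (hz : z ∈ D) : ∑ w ∈ D.erase z, w = ∑ w ∈ D, w - z := by
    rw [← Finset.add_sum_erase D (fun w => w) hz]; ring
  rcases hB with hB | hB <;> rcases hC with hC | hC
  · rw [left hB, left hC] at h
    rw [← Finset.insert_erase hB.1, h, Finset.insert_erase hC.1]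
  · rw [left hB, right hC] at h
    have h' := congrArg (fun D => ∑ w ∈ D, w) h
    simp only [sum hB.1, sum hC.2, hp, hq] at h'
    exact absurd ⟨p - q, by push_cast; linarith⟩ hxy
  · rw [right hB, left hC] at h
    have h' := congrArg (fun D => ∑ w ∈ D, w) h
    simp only [sum hB.2, sum hC.1, hp, hq] at h'
    exact absurd ⟨q - p, by push_cast; linarith⟩ hxy
  · rw [right hB, right hC] at h
    rw [← Finset.insert_erase hB.2, h, Finset.insert_erase hC.2]

/-- At most `(n-2).choose (r-1)` of the `r`-subsets with rational sum separate `x` from `y` when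
`x - y` is irrational. -/
lemma card_separating_le {A : Finset ℝ} {r : ℕ} {F : Finset (Finset ℝ)}
    (hF : ∀ B ∈ F, B ⊆ A ∧ B.card = r ∧ ∃ q : ℚ, ∑ z ∈ B, z = (q : ℝ))
    {x y : ℝ} (hx : x ∈ A) (hy : y ∈ A) (hxy : Irrational (x - y)) :
    (F.filter fun B => x ∈ B ∧ y ∉ B ∨ x ∉ B ∧ y ∈ B).card ≤ (A.card - 2).choose (r - 1) := by
  have hne : y ≠ x := by
    rintro rfl
    exact hxy ⟨0, by simp⟩
  have hcard : ((A.erase x).erase y).card = A.card - 2 := by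
    rw [Finset.card_erase_of_mem (Finset.mem_erase.2 ⟨hne, hy⟩), Finset.card_erase_of_mem hx]
    omega
  rw [← hcard, ← Finset.card_powersetCard]
  refine Finset.card_le_card_of_injOn (fun B => (B.erase x).erase y) ?_ ?_
  · intro B hB
    obtain ⟨hBF, hB⟩ := Finset.mem_filter.1 hB
    obtain ⟨hBA, hBr, -⟩ := hF B hBF
    refine Finset.mem_powersetCard.2
      ⟨Finset.erase_subset_erase _ (Finset.erase_subset_erase _ hBA), ?_⟩
    dsimp only
    rcases hB with hB | hB
    · rw [Finset.erase_eq_of_notMem fun hy => hB.2 (Finset.mem_of_mem_erase hy),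
        Finset.card_erase_of_mem hB.1, hBr]
    · rw [Finset.erase_eq_of_notMem hB.1, Finset.card_erase_of_mem hB.2, hBr]
  · intro B hB C hC h
    obtain ⟨hBF, hB⟩ := Finset.mem_filter.1 hB
    obtain ⟨hCF, hC⟩ := Finset.mem_filter.1 hC
    exact eq_of_erase_erase_eq hxy hB hC (hF B hBF).2.2 (hF C hCF).2.2 h

/-- If `B` contains exactly half of `S ∪ T`, at least half of the pairs in `S ×ˢ T` are separated
by `B`. -/
lemma card_mul_card_le_two_mul_separated {α : Type*} [DecidableEq α] {S T B : Finset α}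
    (hST : Disjoint S T) (hB : B ⊆ S ∪ T) (hcard : S.card + T.card = 2 * B.card) :
    S.card * T.card ≤
      2 * ((S ×ˢ T).filter fun p => p.1 ∈ B ∧ p.2 ∉ B ∨ p.1 ∉ B ∧ p.2 ∈ B).card := by
  have hS := Finset.card_inter_add_card_sdiff S B
  have hT := Finset.card_inter_add_card_sdiff T B
  have hBc : (S ∩ B).card + (T ∩ B).card = B.card := by
    rw [← Finset.card_union_of_disjoint
      (hST.mono Finset.inter_subset_left Finset.inter_subset_left),
      ← Finset.union_inter_distrib_right, Finset.inter_eq_right.2 hB]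
  have hdisj : Disjoint ((S ∩ B) ×ˢ (T \ B)) ((S \ B) ×ˢ (T ∩ B)) := by
    rw [Finset.disjoint_left]
    rintro ⟨a, b⟩ h h'
    simp only [Finset.mem_product, Finset.mem_inter, Finset.mem_sdiff] at h h'
    exact h'.1.2 h.1.2
  have hsub : ((S ∩ B) ×ˢ (T \ B)) ∪ ((S \ B) ×ˢ (T ∩ B)) ⊆
      (S ×ˢ T).filter fun p => p.1 ∈ B ∧ p.2 ∉ B ∨ p.1 ∉ B ∧ p.2 ∈ B := by
    rintro ⟨a, b⟩ h
    simp only [Finset.mem_union, Finset.mem_product, Finset.mem_inter, Finset.mem_sdiff,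
      Finset.mem_filter] at h ⊢
    tauto
  have hle := Finset.card_le_card hsub
  rw [Finset.card_union_of_disjoint hdisj, Finset.card_product, Finset.card_product] at hle
  refine le_trans ?_ (Nat.mul_le_mul_left 2 hle)
  rw [← hS, ← hT]
  zify at *
  nlinarith [sq_nonneg (((S ∩ B).card : ℤ) - (S \ B).card)]

lemma ratSumCount_le {A : Finset ℝ} {r : ℕ} (hr : 2 ≤ r) (hA : A.card = 2 * r)
    (hirr : ∀ x ∈ A, Irrational x) :
    ratSumCount A r ≤ 2 * (2 * r - 2).choose (r - 1) := by
  classical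
  unfold ratSumCount
  set F := (A.powersetCard r).filter (fun B => ∃ q : ℚ, (∑ x ∈ B, x) = (q : ℝ)) with hFdef
  have hF : ∀ B ∈ F, B ⊆ A ∧ B.card = r ∧ ∃ q : ℚ, ∑ z ∈ B, z = (q : ℝ) := by
    intro B hB
    obtain ⟨h₁, h₂⟩ := Finset.mem_filter.1 hB
    exact ⟨(Finset.mem_powersetCard.1 h₁).1, (Finset.mem_powersetCard.1 h₁).2, h₂⟩
  obtain ⟨a, ha⟩ : A.Nonempty := Finset.card_pos.1 (by omega)
  set S := A.filter (fun x => ∃ q : ℚ, x - a = (q : ℝ)) with hSdef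
  set T := A.filter (fun x => ¬ ∃ q : ℚ, x - a = (q : ℝ)) with hTdef
  have hdisj : Disjoint S T := Finset.disjoint_filter_filter_not _ _ _
  have hunion : S ∪ T = A := Finset.filter_union_filter_not_eq _ _
  have hcard : S.card + T.card = 2 * r := by
    rw [← Finset.card_union_of_disjoint hdisj, hunion, hA]
  have hS : 0 < S.card :=
    Finset.card_pos.2 ⟨a, Finset.mem_filter.2 ⟨ha, 0, by simp⟩⟩
  rcases T.eq_empty_or_nonempty with hT | hT
  · have hF0 : F = ∅ := by
      refine Finset.eq_empty_of_forall_notMem fun B hB => ?_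
      obtain ⟨hBA, hBr, q, hq⟩ := hF B hB
      have hrat : ∀ x ∈ B, ∃ p : ℚ, x - a = (p : ℝ) := by
        intro x hx
        by_contra h
        have : x ∈ T := Finset.mem_filter.2 ⟨hBA hx, h⟩
        simp [hT] at this
      choose! p hp using hrat
      have hsum : ∑ x ∈ B, x - r * a = ((∑ x ∈ B, p x : ℚ) : ℝ) := by
        rw [← hBr, ← nsmul_eq_mul, ← Finset.sum_const, ← Finset.sum_sub_distrib, Rat.cast_sum]
        exact Finset.sum_congr rfl hp
      refine (hirr a ha).natCast_mul (m := r) (by omega) ⟨q - ∑ x ∈ B, p x, ?_⟩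
      rw [Rat.cast_sub, ← hsum, ← hq]
      ring
    simp [hF0]
  · have hpos : 0 < S.card * T.card := Nat.mul_pos hS hT.card_pos
    have hlow : F.card * (S.card * T.card) ≤ 2 * ∑ B ∈ F,
        ((S ×ˢ T).filter fun p => p.1 ∈ B ∧ p.2 ∉ B ∨ p.1 ∉ B ∧ p.2 ∈ B).card := by
      rw [Finset.mul_sum, ← smul_eq_mul]
      refine Finset.card_nsmul_le_sum _ _ _ fun B hB => ?_
      exact card_mul_card_le_two_mul_separated hdisj (hunion ▸ (hF B hB).1)
        (by rw [hcard, (hF B hB).2.1])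
    have hup : ∑ B ∈ F, ((S ×ˢ T).filter fun p => p.1 ∈ B ∧ p.2 ∉ B ∨ p.1 ∉ B ∧ p.2 ∈ B).card ≤
        (S.card * T.card) * (2 * r - 2).choose (r - 1) := by
      rw [← Finset.card_product, ← smul_eq_mul]
      refine le_trans (Finset.sum_card_bipartiteAbove_eq_sum_card_bipartiteBelow
        (fun (B : Finset ℝ) (p : ℝ × ℝ) => p.1 ∈ B ∧ p.2 ∉ B ∨ p.1 ∉ B ∧ p.2 ∈ B)).le
        (Finset.sum_le_card_nsmul _ _ _ fun p hp => ?_)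
      obtain ⟨hp₁, hp₂⟩ := Finset.mem_product.1 hp
      obtain ⟨hx, q, hq⟩ := Finset.mem_filter.1 hp₁
      obtain ⟨hy, hyq⟩ := Finset.mem_filter.1 hp₂
      rw [← hA]
      refine card_separating_le hF hx hy ?_
      rintro ⟨s, hs⟩
      exact hyq ⟨q - s, by push_cast; linarith⟩
    refine Nat.le_of_mul_le_mul_right ?_ hpos
    calc _ ≤ _ := hlow
      _ ≤ _ := Nat.mul_le_mul_left 2 hup
      _ = _ := by ring

/-- The `r`-sets consisting of one element of `E` and `r - 1` elements of `M` number
`E.card * M.card.choose (r - 1)`. -/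
lemma card_mul_choose_le_ratSumCount {E M : Finset ℝ} (hEM : Disjoint E M) {r : ℕ} (hr : 1 ≤ r)
    (hq : ∀ e ∈ E, ∀ C ⊆ M, C.card = r - 1 → ∃ q : ℚ, e + ∑ x ∈ C, x = (q : ℝ)) :
    E.card * M.card.choose (r - 1) ≤ ratSumCount (E ∪ M) r := by
  classical
  unfold ratSumCount
  rw [← Finset.card_powersetCard, ← Finset.card_product]
  have hnot : ∀ p ∈ E ×ˢ M.powersetCard (r - 1), p.1 ∉ M ∧ p.1 ∉ p.2 := by
    intro p hp
    obtain ⟨he, hC⟩ := Finset.mem_product.1 hp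
    have := Finset.disjoint_left.1 hEM he
    exact ⟨this, fun h => this ((Finset.mem_powersetCard.1 hC).1 h)⟩
  refine Finset.card_le_card_of_injOn (fun p => insert p.1 p.2) ?_ ?_
  · intro p hp
    obtain ⟨he, hC⟩ := Finset.mem_product.1 hp
    obtain ⟨hCM, hCr⟩ := Finset.mem_powersetCard.1 hC
    have hn := (hnot p hp).2
    refine Finset.mem_filter.2 ⟨Finset.mem_powersetCard.2 ⟨?_, ?_⟩, ?_⟩
    · exact Finset.insert_subset (Finset.mem_union_left _ he)
        (hCM.trans Finset.subset_union_right)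
    · rw [Finset.card_insert_of_notMem hn, hCr]; omega
    · simpa [Finset.sum_insert hn] using hq _ he _ hCM hCr
  · intro p hp p' hp' h
    have hsub {p : ℝ × Finset ℝ} (hp : p ∈ E ×ˢ M.powersetCard (r - 1)) :
        insert p.1 p.2 ∩ M = p.2 := by
      rw [Finset.insert_inter_of_notMem (hnot p hp).1]
      exact Finset.inter_eq_left.2 (Finset.mem_powersetCard.1 (Finset.mem_product.1 hp).2).1
    replace h : insert p.1 p.2 = insert p'.1 p'.2 := h
    have h₂ : p.2 = p'.2 := by rw [← hsub hp, h, hsub hp']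
    have h₁ : p.1 ∈ insert p'.1 p'.2 := h ▸ Finset.mem_insert_self _ _
    rcases Finset.mem_insert.1 h₁ with h₁ | h₁
    · exact Prod.ext h₁ h₂
    · exact absurd (h₂ ▸ h₁) (hnot p hp).2

lemma exists_le_ratSumCount {r : ℕ} (hr : 2 ≤ r) :
    ∃ A : Finset ℝ, A.card = 2 * r ∧ (∀ x ∈ A, Irrational x) ∧
      2 * (2 * r - 2).choose (r - 1) ≤ ratSumCount A r := by
  set f : ℕ → ℝ := fun i => √2 + i with hf
  set g : ℕ → ℝ := fun i => -((r - 1 : ℕ) * √2) + i with hg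
  have hcast : ((r - 1 : ℕ) : ℝ) = r - 1 := by rw [Nat.cast_sub (by omega)]; simp
  have hfinj : Function.Injective f := fun i j h => by simpa [hf] using h
  have hginj : Function.Injective g := fun i j h => by simpa [hg] using h
  set M := (Finset.range (2 * r - 2)).image f with hM
  set E := (Finset.range 2).image g with hE
  have hMc : M.card = 2 * r - 2 := by
    rw [hM, Finset.card_image_of_injective _ hfinj, Finset.card_range]
  have hEc : E.card = 2 := by
    rw [hE, Finset.card_image_of_injective _ hginj, Finset.card_range]
  have hdisj : Disjoint E M := by
    rw [Finset.disjoint_left]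
    intro x hxE hxM
    obtain ⟨i, -, rfl⟩ := Finset.mem_image.1 hxE
    obtain ⟨j, -, hj⟩ := Finset.mem_image.1 hxM
    refine irrational_sqrt_two.natCast_mul (m := r) (by omega) ⟨i - j, ?_⟩
    simp only [hf, hg, hcast] at hj
    push_cast
    linarith
  refine ⟨E ∪ M, ?_, ?_, ?_⟩
  · rw [Finset.card_union_of_disjoint hdisj, hMc, hEc]; omega
  · intro x hx
    rcases Finset.mem_union.1 hx with hx | hx <;> obtain ⟨i, -, rfl⟩ := Finset.mem_image.1 hx
    · exact (irrational_sqrt_two.natCast_mul (by omega)).neg.add_natCast i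
    · exact irrational_sqrt_two.add_natCast i
  · have key := card_mul_choose_le_ratSumCount hdisj (r := r) (by omega) ?_
    · rwa [hMc, hEc] at key
    · intro e he C hCM hCr
      obtain ⟨i, -, rfl⟩ := Finset.mem_image.1 he
      have hrat : ∀ x ∈ C, ∃ k : ℕ, x - √2 = (k : ℝ) := by
        intro x hx
        obtain ⟨k, -, rfl⟩ := Finset.mem_image.1 (hCM hx)
        exact ⟨k, by simp [hf]⟩
      choose! k hk using hrat
      have hsum : ∑ x ∈ C, x - (r - 1 : ℕ) * √2 = ((∑ x ∈ C, k x : ℕ) : ℝ) := by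
        rw [← hCr, ← nsmul_eq_mul, ← Finset.sum_const, ← Finset.sum_sub_distrib, Nat.cast_sum]
        exact Finset.sum_congr rfl hk
      refine ⟨i + (∑ x ∈ C, k x : ℕ), ?_⟩
      rw [Rat.cast_add, Rat.cast_natCast, Rat.cast_natCast, ← hsum]
      simp only [hg]
      ring

theorem h_half (n r : ℕ) (hr : 2 ≤ r) (hn : n = 2 * r) :
    maxRatSum n (n / 2) = 2 * Nat.choose (n - 2) (r - 1) := by
  subst hn
  rw [Nat.mul_div_cancel_left r two_pos]
  refine IsGreatest.csSup_eq ⟨?_, ?_⟩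
  · obtain ⟨A, hA, hirr, hle⟩ := exists_le_ratSumCount hr
    exact ⟨A, hA, hirr, le_antisymm (ratSumCount_le hr hA hirr) hle⟩
  · rintro k ⟨A, hA, hirr, rfl⟩
    exact ratSumCount_le hr hA hirr
end
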